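/- The map (a,b,x) ↦ φ_{a,b}(x) is continuous on (ℝ/ℤ × [0,1]) × ℝ/ℤ, where φ_{a,b} is the semiconjugacy between f_{a,b} and the doubling map. -/

import Mathlib

open Set Filter Topology

noncomputable section

/-- Representative of a point of the circle in `[0,1)`. -/
noncomputable def rep (z : UnitAddCircle) : ℝ := (AddCircle.equivIco 1 0 z).val

/-- The straight sine map on `[0,1)`. -/
noncomputable def Sfun (t : ℝ) : ℝ := if t ≤ 1/2 then 4*t - 1 else -4*t + 3

/-- The piecewise linear perturbation of the doubling map. -/
noncomputable def plpdm (a : UnitAddCircle) (b : ℝ) (z : UnitAddCircle) : UnitAddCircle :=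
  ((2 * rep z + (b/2) * Sfun (rep z) : ℝ) : UnitAddCircle) + a

/-- The doubling map. -/
def Dbl (z : UnitAddCircle) : UnitAddCircle := z + z

/-- `x` is an attracting periodic point of `f` of exact period `n`. -/
def IsAttractingPeriodicPt (f : UnitAddCircle → UnitAddCircle) (n : ℕ)
    (x : UnitAddCircle) : Prop :=
  0 < n ∧ f^[n] x = x ∧ (∀ m, 0 < m → m < n → f^[m] x ≠ x) ∧
  ∃ U : Set UnitAddCircle, IsOpen U ∧ IsConnected U ∧ x ∈ U ∧ f^[n] '' U ⊆ U ∧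
    ∀ y ∈ U, Tendsto (fun k => f^[n*k] y) atTop (nhds x)

/-- Forward orbit of `x` under `f`. -/
def orbitSet (f : UnitAddCircle → UnitAddCircle) (x : UnitAddCircle) : Set UnitAddCircle :=
  {y | ∃ i, f^[i] x = y}

/-- Basin of attraction of the set `O`. -/
def basin (f : UnitAddCircle → UnitAddCircle) (O : Set UnitAddCircle) : Set UnitAddCircle :=
  {y | Tendsto (fun k => Metric.infDist (f^[k] y) O) atTop (nhds 0)}

/-- Immediate basin of attraction of the orbit `O`. -/
def immBasin (f : UnitAddCircle → UnitAddCircle) (O : Set UnitAddCircle) :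
    Set UnitAddCircle :=
  ⋃ z ∈ O, connectedComponentIn (basin f O) z

/-- The hyperbolic set `H`. -/
def hypSet : Set (UnitAddCircle × ℝ) :=
  {q | q.2 ∈ Set.Ico (0:ℝ) 1 ∧ ∃ n x, IsAttractingPeriodicPt (plpdm q.1 q.2) n x}

/-- The lift `F_{a,b}` of `f_{a,b}`, normalized so that `F_{a,b}(0) ∈ [0,1)`. -/
noncomputable def liftF (a : UnitAddCircle) (b : ℝ) (x : ℝ) : ℝ :=
  (2 * Int.fract x + rep a + (b/2) * Sfun (Int.fract x)
    + (if rep a - b/2 < 0 then 1 else 0)) + 2 * (⌊x⌋ : ℝ)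

/-- `Φ_{a,b}`, the limit of `F_{a,b}^n(x)/2^n`. -/
noncomputable def Phi (a : UnitAddCircle) (b : ℝ) (x : ℝ) : ℝ :=
  limUnder atTop (fun n : ℕ => (liftF a b)^[n] x / 2 ^ n)

/-- The semiconjugacy `φ_{a,b}` induced by `Φ_{a,b}`. -/
noncomputable def phiMap (a : UnitAddCircle) (b : ℝ) (z : UnitAddCircle) : UnitAddCircle :=
  ((Phi a b (rep z) : ℝ) : UnitAddCircle)

/-- The arc `I₊ = [0,1/2]` of the circle. -/
def Iplus : Set UnitAddCircle := (fun t : ℝ => (t : UnitAddCircle)) '' Set.Icc 0 (1/2)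

/-- The arc `I₋ = [1/2,1]` of the circle. -/
def Iminus : Set UnitAddCircle := (fun t : ℝ => (t : UnitAddCircle)) '' Set.Icc (1/2) 1

/-- The orbit of `x` (of period `p`) avoids `0`, `1/2` and has slope itinerary `σ`,
where `σ j = true` encodes the symbol `−` and `σ j = false` encodes `+`. -/
def HasItinerary (f : UnitAddCircle → UnitAddCircle) (p : ℕ) (x : UnitAddCircle)
    (σ : Fin p → Bool) : Prop :=
  (∀ j : Fin p, f^[(j : ℕ)] x ≠ (0 : UnitAddCircle) ∧
      f^[(j : ℕ)] x ≠ (((1:ℝ)/2 : ℝ) : UnitAddCircle)) ∧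
  ∀ j : Fin p, (σ j = true → f^[(j : ℕ)] x ∈ Iminus) ∧ (σ j = false → f^[(j : ℕ)] x ∈ Iplus)

/-- The set `P_σ` of parameters whose attracting orbit has slope itinerary `σ`. -/
def paramSet (p : ℕ) (σ : Fin p → Bool) : Set (UnitAddCircle × ℝ) :=
  {q | q.2 ∈ Set.Ico (0:ℝ) 1 ∧ ∃ x, IsAttractingPeriodicPt (plpdm q.1 q.2) p x ∧
       HasItinerary (plpdm q.1 q.2) p x σ}

/-- `S` is a tongue: its closure meets `ℝ/ℤ × {1}` in a nondegenerate interval. -/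
def IsTongue (S : Set (UnitAddCircle × ℝ)) : Prop :=
  ∃ u v : ℝ, u < v ∧ ∀ t ∈ Set.Icc u v, (((t : ℝ) : UnitAddCircle), (1:ℝ)) ∈ closure S

end


theorem rep_coe (x : ℝ) : rep (x : UnitAddCircle) = Int.fract x := by
  simp [rep]

theorem coe_intCast (n : ℤ) : ((n : ℝ) : UnitAddCircle) = 0 := by
  rw [AddCircle.coe_eq_zero_iff]
  exact ⟨n, by simp⟩

theorem coe_fract (x : ℝ) : ((Int.fract x : ℝ) : UnitAddCircle) = x := by
  rw [← Int.self_sub_floor, AddCircle.coe_sub, coe_intCast, sub_zero]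

theorem coe_rep (z : UnitAddCircle) : ((rep z : ℝ) : UnitAddCircle) = z := by
  induction z using QuotientAddGroup.induction_on with
  | H x => exact (congrArg _ (rep_coe x)).trans (coe_fract x)

theorem Sfun_eq (t : ℝ) : Sfun t = 1 - 4 * |t - 1 / 2| := by
  unfold Sfun
  split_ifs with h
  · rw [abs_of_nonpos (by linarith)]; ring
  · rw [abs_of_pos (by linarith)]; ring

theorem continuous_Sfun_rep : Continuous fun z : UnitAddCircle => Sfun (rep z) := by
  refine (QuotientAddGroup.isQuotientMap_mk (AddSubgroup.zmultiples (1 : ℝ))).continuous_iff.2 ?_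
  have h : Continuous ((fun t : ℝ => 1 - 4 * |t - 1 / 2|) ∘ Int.fract) :=
    ContinuousOn.comp_fract'' (by fun_prop) (by norm_num [abs_of_pos])
  refine h.congr fun x => ?_
  exact ((congrArg Sfun (rep_coe x)).trans (Sfun_eq _)).symm

theorem abs_Sfun_rep_le_one (z : UnitAddCircle) : |Sfun (rep z)| ≤ 1 := by
  have h := (AddCircle.equivIco 1 0 z).2
  have h0 : 0 ≤ rep z := h.1
  have h1 : rep z < 1 := lt_of_lt_of_eq h.2 (zero_add 1)
  have h2 : |rep z - 1 / 2| ≤ 1 / 2 := abs_le.2 ⟨by linarith, by linarith⟩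
  rw [Sfun_eq, abs_le]
  constructor <;> linarith [abs_nonneg (rep z - 1 / 2)]

theorem plpdm_eq (a : UnitAddCircle) (b : ℝ) (z : UnitAddCircle) :
    plpdm a b z = z + z + ((b / 2 * Sfun (rep z) : ℝ) : UnitAddCircle) + a := by
  rw [plpdm, AddCircle.coe_add, two_mul, AddCircle.coe_add, coe_rep]

theorem continuous_plpdm_iterate (n : ℕ) :
    Continuous fun q : (UnitAddCircle × ℝ) × UnitAddCircle => (plpdm q.1.1 q.1.2)^[n] q.2 := by
  induction n with
  | zero => exact continuous_snd
  | succ n ih =>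
    simp only [Function.iterate_succ_apply', plpdm_eq]
    have hS := continuous_Sfun_rep.comp ih
    have hb : Continuous fun q : (UnitAddCircle × ℝ) × UnitAddCircle =>
        q.1.2 / 2 * Sfun (rep ((plpdm q.1.1 q.1.2)^[n] q.2)) :=
      (by fun_prop : Continuous fun q : (UnitAddCircle × ℝ) × UnitAddCircle => q.1.2 / 2).mul hS
    exact ((ih.add ih).add ((AddCircle.continuous_mk' 1).comp hb)).add
      (continuous_fst.comp continuous_fst)

/-- The representative of the rotation parameter `a` used by the normalized lift. -/
noncomputable def liftShift (a : UnitAddCircle) (b : ℝ) : ℝ :=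
  rep a + if rep a - b / 2 < 0 then 1 else 0

theorem coe_liftShift (a : UnitAddCircle) (b : ℝ) : ((liftShift a b : ℝ) : UnitAddCircle) = a := by
  unfold liftShift
  split_ifs <;> simp [coe_rep]

theorem liftF_eq (a : UnitAddCircle) (b x : ℝ) :
    liftF a b x = 2 * x + liftShift a b + b / 2 * Sfun (rep (x : UnitAddCircle)) := by
  rw [liftF, rep_coe, liftShift]
  linarith [Int.floor_add_fract x]

theorem coe_liftF (a : UnitAddCircle) (b x : ℝ) :
    ((liftF a b x : ℝ) : UnitAddCircle) = plpdm a b x := by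
  rw [liftF_eq, plpdm_eq, two_mul]
  simp only [AddCircle.coe_add, coe_liftShift]
  abel

theorem coe_liftF_iterate (a : UnitAddCircle) (b x : ℝ) (n : ℕ) :
    (((liftF a b)^[n] x : ℝ) : UnitAddCircle) = (plpdm a b)^[n] x :=
  (show Function.Semiconj (fun t : ℝ => (t : UnitAddCircle)) (liftF a b) (plpdm a b) from
    coe_liftF a b).iterate_right n x

/-- The geometrically weighted sum of the straight sine map along an orbit of `plpdm a b`. -/
noncomputable def orbitSum (a : UnitAddCircle) (b : ℝ) (z : UnitAddCircle) : ℝ :=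
  ∑' n : ℕ, Sfun (rep ((plpdm a b)^[n] z)) * (1 / 2 / 2 ^ n)

theorem norm_orbitSum_term_le (a : UnitAddCircle) (b : ℝ) (z : UnitAddCircle) (n : ℕ) :
    ‖Sfun (rep ((plpdm a b)^[n] z)) * (1 / 2 / 2 ^ n)‖ ≤ 1 / 2 / 2 ^ n := by
  have h : (0 : ℝ) ≤ 1 / 2 / 2 ^ n := by positivity
  rw [norm_mul, Real.norm_of_nonneg h]
  exact mul_le_of_le_one_left h (abs_Sfun_rep_le_one _)

theorem continuous_orbitSum :
    Continuous fun q : (UnitAddCircle × ℝ) × UnitAddCircle => orbitSum q.1.1 q.1.2 q.2 :=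
  continuous_tsum
    (fun n => (continuous_Sfun_rep.comp (continuous_plpdm_iterate n)).mul continuous_const)
    (summable_geometric_two' 1) fun n q => norm_orbitSum_term_le q.1.1 q.1.2 q.2 n

theorem liftF_iterate_div (a : UnitAddCircle) (b x : ℝ) (n : ℕ) :
    (liftF a b)^[n] x / 2 ^ n = x + liftShift a b * (1 - (1 / 2) ^ n) +
      b / 2 * ∑ i ∈ Finset.range n, Sfun (rep ((plpdm a b)^[i] x)) * (1 / 2 / 2 ^ i) := by
  induction n with
  | zero => simp
  | succ n ih =>
    have h : (liftF a b)^[n + 1] x / 2 ^ (n + 1) = (liftF a b)^[n] x / 2 ^ n +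
        (liftShift a b + b / 2 * Sfun (rep ((plpdm a b)^[n] x))) * (1 / 2 / 2 ^ n) := by
      rw [Function.iterate_succ_apply', liftF_eq, coe_liftF_iterate]
      field_simp
      ring
    rw [h, ih, Finset.sum_range_succ, pow_succ, div_pow, one_pow]
    ring

theorem Phi_eq (a : UnitAddCircle) (b x : ℝ) :
    Phi a b x = x + liftShift a b + b / 2 * orbitSum a b x := by
  have hs : Summable fun n : ℕ => Sfun (rep ((plpdm a b)^[n] x)) * (1 / 2 / 2 ^ n) :=
    (summable_geometric_two' 1).of_norm_bounded (norm_orbitSum_term_le a b x)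
  have hp : Tendsto (fun n : ℕ => (1 / 2 : ℝ) ^ n) atTop (𝓝 0) :=
    tendsto_pow_atTop_nhds_zero_of_lt_one (by norm_num) (by norm_num)
  refine Tendsto.limUnder_eq ?_
  simp only [liftF_iterate_div]
  have h := (((hp.const_sub 1).const_mul (liftShift a b)).const_add x).add
    (hs.hasSum.tendsto_sum_nat.const_mul (b / 2))
  simpa [orbitSum] using h

theorem phiMap_eq (a : UnitAddCircle) (b : ℝ) (z : UnitAddCircle) :
    phiMap a b z = z + a + ((b / 2 * orbitSum a b z : ℝ) : UnitAddCircle) := by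
  rw [phiMap, Phi_eq]
  simp only [AddCircle.coe_add, coe_liftShift, coe_rep]

theorem stmt6 :
    ContinuousOn (fun q : (UnitAddCircle × ℝ) × UnitAddCircle => phiMap q.1.1 q.1.2 q.2)
      {q : (UnitAddCircle × ℝ) × UnitAddCircle | q.1.2 ∈ Set.Icc (0:ℝ) 1} := by
  refine Continuous.continuousOn ?_
  simp only [phiMap_eq]
  have hb : Continuous fun q : (UnitAddCircle × ℝ) × UnitAddCircle =>
      q.1.2 / 2 * orbitSum q.1.1 q.1.2 q.2 :=
    (by fun_prop : Continuous fun q : (UnitAddCircle × ℝ) × UnitAddCircle => q.1.2 / 2).mul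
      continuous_orbitSum
  exact (continuous_snd.add (continuous_fst.comp continuous_fst)).add
    ((AddCircle.continuous_mk' 1).comp hb)
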